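/- Let X, Y be real Hilbert spaces, K : X → Y bounded linear, τ, σ, φ > 0, η := φτ, and let M be as in the context. Let γ, ρ, γE, γ̂, L̄ ≥ 0 with γ̂ ≥ γE, γ̄ ∈ ℝ, ē ≥ 0, κ ∈ (0, 1), and assume max{−2(γ + γ̄), 2L̄/(1 − κ)}·τ + τσ‖K‖² ≤ 1 and θ := φ(1 + 2τ·min{γ + γ̄, L̄} − τσ‖K‖²) > 0. Let F : X → ℝ ∪ {+∞} and G* : Y → ℝ ∪ {+∞} be proper convex, E : X → ℝ Fréchet differentiable, and g ∈ X. Let u = (x, y), ŭ = (x̆, y̆), ū = (x̄, ȳ) ∈ X × Y and suppose: (a) for every critical point (x̂, ŷ) and every x' ∈ X, ⟨g − ∇E(x̂), x' − x̂⟩ ≥ γ̄‖x' − x̂‖² − L̄‖x' − x̆‖² − ē; (b) there exist a γ-strong subgradient q of F at x and a ρ-strong subgradient p of G* at y with q + g + K*y + τ⁻¹(x − x̆) − K*(y − y̆) = 0 and p − Kx + σ⁻¹(y − y̆) − K(x − x̆) = 0; (c) for some r̂ > 0, the infimum of ‖ū − û‖_{M+Γ̂} over all critical points û is at most r̂, where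 ‖(a, b)‖²_{M+Γ̂} := ⟨M(a, b), (a, b)⟩ + 2(γ + γ̂)‖a‖² + 2ρ‖b‖²; (d) for some Δ > 0, ξ > 0 and 0 < δ̃ < δ it holds that η⟨M(ŭ − ū), ŭ − ū⟩ ≤ θ(δ − δ̃)²/ξ − (1 + Δ)ηr̂²/ξ and (2 − κ)(ξ⁻¹ + 1)(δ − δ̃)² + 2θ⁻¹ηē ≤ δ̃². Then there exists a critical point û = (x̂, ŷ) with ‖ū − û‖²_{M+Γ̂} ≤ (1 + Δ)r̂², and moreover ‖x − x̂‖ < δ, ‖x̆ − x̂‖ < δ, ‖x̆ − x̄‖ < δ and ‖x − x̄‖ < δ. -/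

import Mathlib

open scoped RealInnerProductSpace

/-- The quadratic form `⟨M u, u⟩` of the primal-dual preconditioning operator
`M(x, y) := (τ⁻¹ x − K* y, σ⁻¹ y − K x)` on the product Hilbert space `X × Y`. -/
noncomputable def Mquad {X Y : Type*} [NormedAddCommGroup X] [InnerProductSpace ℝ X]
    [CompleteSpace X] [NormedAddCommGroup Y] [InnerProductSpace ℝ Y] [CompleteSpace Y]
    (K : X →L[ℝ] Y) (τ σ : ℝ) (u : X × Y) : ℝ :=
  ⟪τ⁻¹ • u.1 - (ContinuousLinearMap.adjoint K) u.2, u.1⟫ +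
    ⟪σ⁻¹ • u.2 - K u.1, u.2⟫

/-- `q` is a `γ`-strong subgradient of the extended-real-valued convex function `F` at `x`. -/
def IsStrongSubgradient {X : Type*} [NormedAddCommGroup X] [InnerProductSpace ℝ X]
    (γ : ℝ) (F : X → EReal) (x q : X) : Prop :=
  F x ≠ ⊤ ∧ F x ≠ ⊥ ∧
    ∀ x' : X, F x' ≥ F x + ((⟪q, x' - x⟫ + γ / 2 * ‖x' - x‖ ^ 2 : ℝ) : EReal)

/-- `F` is proper (nowhere `−∞`, finite somewhere) and convex. -/
def ProperConvex {X : Type*} [NormedAddCommGroup X] [InnerProductSpace ℝ X]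
    (F : X → EReal) : Prop :=
  (∀ v, F v ≠ ⊥) ∧ (∃ v, F v ≠ ⊤) ∧
    ∀ v w : X, ∀ t : ℝ, 0 ≤ t → t ≤ 1 →
      F (t • v + (1 - t) • w) ≤ (t : EReal) * F v + ((1 - t : ℝ) : EReal) * F w

/-- `(x̂, ŷ)` is a primal-dual critical point of `F + E + G ∘ K`:
`0 ∈ ∂F(x̂) + ∇E(x̂) + K*ŷ` and `Kx̂ ∈ ∂G*(ŷ)`, with strong subgradients. -/
def IsCriticalPoint {X Y : Type*} [NormedAddCommGroup X] [InnerProductSpace ℝ X]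
    [CompleteSpace X] [NormedAddCommGroup Y] [InnerProductSpace ℝ Y] [CompleteSpace Y]
    (γ ρ : ℝ) (F : X → EReal) (Gs : Y → EReal) (E' : X → X) (K : X →L[ℝ] Y)
    (v : X × Y) : Prop :=
  ∃ q p, IsStrongSubgradient γ F v.1 q ∧ IsStrongSubgradient ρ Gs v.2 p ∧
    q + E' v.1 + (ContinuousLinearMap.adjoint K) v.2 = 0 ∧ p = K v.1

theorem IsStrongSubgradient.inner_sub_ge {X : Type*} [NormedAddCommGroup X]
    [InnerProductSpace ℝ X] {γ : ℝ} {F : X → EReal} {x x' q q' : X}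
    (h : IsStrongSubgradient γ F x q) (h' : IsStrongSubgradient γ F x' q') :
    γ * ‖x - x'‖ ^ 2 ≤ ⟪q - q', x - x'⟫ := by
  obtain ⟨h1, h2, h3⟩ := h
  obtain ⟨h1', h2', h3'⟩ := h'
  have e := h3 x'
  have e' := h3' x
  lift F x to ℝ using ⟨h1, h2⟩ with a
  lift F x' to ℝ using ⟨h1', h2'⟩ with b
  norm_cast at e e'
  rw [norm_sub_rev x' x, ← neg_sub x x', inner_neg_right] at e
  rw [inner_sub_left]
  linarith

section Mquad

variable {X Y : Type*} [NormedAddCommGroup X] [InnerProductSpace ℝ X] [CompleteSpace X]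
  [NormedAddCommGroup Y] [InnerProductSpace ℝ Y] [CompleteSpace Y]

theorem Mquad_eq (K : X →L[ℝ] Y) (τ σ : ℝ) (u : X × Y) :
    Mquad K τ σ u = τ⁻¹ * ‖u.1‖ ^ 2 - 2 * ⟪K u.1, u.2⟫ + σ⁻¹ * ‖u.2‖ ^ 2 := by
  rw [Mquad, inner_sub_left, inner_sub_left, ContinuousLinearMap.adjoint_inner_left,
    real_inner_smul_left, real_inner_smul_left, real_inner_self_eq_norm_sq,
    real_inner_self_eq_norm_sq, real_inner_comm u.2 (K u.1)]
  ring

theorem mul_Mquad_ge (K : X →L[ℝ] Y) {τ σ : ℝ} (hτ : 0 < τ) (hσ : 0 < σ) (u : X × Y) :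
    (1 - τ * σ * ‖K‖ ^ 2) * ‖u.1‖ ^ 2 ≤ τ * Mquad K τ σ u := by
  have h1 : ‖u.2 - σ • K u.1‖ ^ 2 = ‖u.2‖ ^ 2 - 2 * σ * ⟪K u.1, u.2⟫ + σ ^ 2 * ‖K u.1‖ ^ 2 := by
    rw [norm_sub_sq_real, real_inner_smul_right, norm_smul, mul_pow, Real.norm_eq_abs, sq_abs,
      real_inner_comm]
    ring
  have h2 : τ * Mquad K τ σ u
      = ‖u.1‖ ^ 2 + τ / σ * ‖u.2 - σ • K u.1‖ ^ 2 - τ * σ * ‖K u.1‖ ^ 2 := by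
    rw [h1, Mquad_eq]
    field_simp
    ring
  have h3 : ‖K u.1‖ ^ 2 ≤ ‖K‖ ^ 2 * ‖u.1‖ ^ 2 := by
    rw [← mul_pow]
    gcongr
    exact K.le_opNorm _
  have h4 : 0 ≤ τ / σ * ‖u.2 - σ • K u.1‖ ^ 2 := by positivity
  have h5 := mul_le_mul_of_nonneg_left h3 (mul_pos hτ hσ).le
  rw [h2]
  linarith

/-- Expansion of `Mquad` along a primal direction. -/
theorem mul_Mquad_sub_primal (K : X →L[ℝ] Y) {τ σ : ℝ} (hτ : 0 < τ) (u : X × Y) (v : X) :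
    τ * Mquad K τ σ (u.1 - v, u.2) = τ * Mquad K τ σ u
      - 2 * ⟪u.1 - τ • (ContinuousLinearMap.adjoint K) u.2, v⟫ + ‖v‖ ^ 2 := by
  rw [Mquad_eq, Mquad_eq, inner_sub_left, real_inner_smul_left,
    ContinuousLinearMap.adjoint_inner_left, map_sub, inner_sub_left, norm_sub_sq_real,
    real_inner_comm (K v) u.2]
  field_simp
  ring

theorem Mquad_add_le (K : X →L[ℝ] Y) {τ σ ξ : ℝ} (hξ : 0 < ξ)
    (hM : ∀ w, 0 ≤ Mquad K τ σ w) (u v : X × Y) :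
    Mquad K τ σ (u + v) ≤ (1 + ξ) * Mquad K τ σ u + (1 + ξ⁻¹) * Mquad K τ σ v := by
  have h := mul_nonneg (inv_nonneg.2 hξ.le) (hM (ξ • u - v))
  have e : ξ⁻¹ * Mquad K τ σ (ξ • u - v)
      = (1 + ξ) * Mquad K τ σ u + (1 + ξ⁻¹) * Mquad K τ σ v - Mquad K τ σ (u + v) := by
    simp only [Mquad_eq, Prod.fst_add, Prod.snd_add, Prod.fst_sub, Prod.snd_sub, Prod.smul_fst,
      Prod.smul_snd, map_sub, map_add, map_smul, norm_sub_sq_real, norm_add_sq_real,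
      inner_add_left, inner_add_right, inner_sub_left, inner_sub_right, real_inner_smul_left,
      real_inner_smul_right, norm_smul, mul_pow, Real.norm_eq_abs, sq_abs]
    field_simp
    ring
  linarith

/-- A weighted Young inequality for the form `Mquad`, absorbing a primal indefinite term. -/
theorem Mquad_young (K : X →L[ℝ] Y) {τ σ j α ℓ : ℝ} (hτ : 0 < τ) (hσ : 0 < σ)
    (hj : 0 < j) (hj1 : j < 1) (hα : 1 ≤ α) (hμ : 0 ≤ 1 - τ * σ * ‖K‖ ^ 2)
    (hℓ : ℓ ≤ j * (1 - τ * σ * ‖K‖ ^ 2)) (u : X × Y) (v : X) :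
    2 * ⟪u.1 - τ • (ContinuousLinearMap.adjoint K) u.2, v⟫ + ℓ * ‖v - u.1‖ ^ 2
      ≤ α * (τ * Mquad K τ σ u) + (α⁻¹ + j * (α - 1) ^ 2 / (α * (α - j))) * ‖v‖ ^ 2 := by
  have hα0 : 0 < α := by linarith
  have hαj : 0 < α - j := by linarith
  have hμ1 : 1 - τ * σ * ‖K‖ ^ 2 ≤ 1 := by
    have : 0 ≤ τ * σ * ‖K‖ ^ 2 := by positivity
    linarith
  have h1 := mul_Mquad_ge K hτ hσ (u.1 - α⁻¹ • v, u.2)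
  rw [mul_Mquad_sub_primal K hτ, real_inner_smul_right] at h1
  set μ := 1 - τ * σ * ‖K‖ ^ 2
  set c := ⟪u.1 - τ • (ContinuousLinearMap.adjoint K) u.2, v⟫
  set w := u.1 - α⁻¹ • v with hw
  have e1 : ‖α⁻¹ • v‖ ^ 2 = (α⁻¹) ^ 2 * ‖v‖ ^ 2 := by
    rw [norm_smul, mul_pow, Real.norm_eq_abs, sq_abs]
  have e2 : v - u.1 = (1 - α⁻¹) • v - w := by
    rw [hw]; module
  have e3 : ‖v - u.1‖ ^ 2 = (1 - α⁻¹) ^ 2 * ‖v‖ ^ 2 - 2 * (1 - α⁻¹) * ⟪w, v⟫ + ‖w‖ ^ 2 := by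
    rw [e2, norm_sub_sq_real, real_inner_smul_left, norm_smul, mul_pow, Real.norm_eq_abs, sq_abs,
      real_inner_comm]
    ring
  have h2 : ℓ * ‖v - u.1‖ ^ 2 ≤ j * μ * ‖v - u.1‖ ^ 2 := by gcongr
  set b := j * (α - 1) / (α * (α - j)) with hb
  have h3 : 0 ≤ ‖w + b • v‖ ^ 2 := by positivity
  rw [norm_add_sq_real, real_inner_smul_right, norm_smul, mul_pow, Real.norm_eq_abs, sq_abs] at h3
  have h4 := mul_nonneg (mul_nonneg hμ hαj.le) h3
  have h5 : 0 ≤ (1 - μ) * (j * (α - 1) ^ 2 / (α * (α - j))) * ‖v‖ ^ 2 := by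
    have : 0 ≤ 1 - μ := by linarith
    positivity
  have h6 := mul_le_mul_of_nonneg_left h1 hα0.le
  rw [e1] at h6
  rw [e3] at h2 ⊢
  have key : α * (τ * Mquad K τ σ u) + (α⁻¹ + j * (α - 1) ^ 2 / (α * (α - j))) * ‖v‖ ^ 2
      - 2 * c - j * μ * ((1 - α⁻¹) ^ 2 * ‖v‖ ^ 2 - 2 * (1 - α⁻¹) * ⟪w, v⟫ + ‖w‖ ^ 2)
      = (α * (τ * Mquad K τ σ u - 2 * (α⁻¹ * c) + α⁻¹ ^ 2 * ‖v‖ ^ 2) - α * (μ * ‖w‖ ^ 2))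
        + μ * (α - j) * (‖w‖ ^ 2 + 2 * (b * ⟪w, v⟫) + b ^ 2 * ‖v‖ ^ 2)
        + (1 - μ) * (j * (α - 1) ^ 2 / (α * (α - j))) * ‖v‖ ^ 2 := by
    rw [hb]
    field_simp
    ring
  linarith

end Mquad

theorem mul_sub_le_one_sub {j s p : ℝ} (hj : 0 < j) (hj1 : j < 1) (hs : 0 ≤ s) (hsj : s ≤ j)
    (hp : 0 ≤ p) (hp1 : p ≤ 1) :
    p * (1 + s) * ((1 - j * (1 - j) / (2 - j)) - s * p) ≤ 1 - s ^ 2 / (2 * j) := by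
  have hz : j * (1 - j) / 2 ≤ j * (1 - j) / (2 - j) := by
    apply div_le_div_of_nonneg_left <;> nlinarith
  have h1 : s ^ 2 / (2 * j) = s ^ 2 / 2 + s ^ 2 / (2 * j) * (1 - j) := by
    field_simp; ring
  have h2 : s ^ 2 / (2 * j) ≤ s / 2 := by
    rw [div_le_div_iff₀ (by positivity) (by positivity)]
    nlinarith
  have h2' : s ^ 2 / (2 * j) ≤ j / 2 := by linarith
  set z := j * (1 - j) / (2 - j)
  set d := s ^ 2 / (2 * j)
  have h3 : d * (1 - j) ≤ z := by nlinarith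
  have h4 : d * (1 - j) ≤ s / 2 * (1 - s) := by
    apply mul_le_mul h2 <;> linarith
  have hd : d * (1 - j) ≤ p * z + (1 - p) * (s / 2 * (1 - s)) := by nlinarith
  have h5 : 0 ≤ p * s * z := by
    have : 0 ≤ z := le_trans (by nlinarith) hz
    positivity
  have h6 : 0 ≤ (1 - p) - s * ((1 - p) * (p + 1 / 2)) + s ^ 2 * (p ^ 2 - p / 2) := by
    have hs1 : s ≤ 1 := by linarith
    nlinarith [sq_nonneg (1 - 2 * p), mul_nonneg hs hp,
      mul_nonneg (sub_nonneg.2 hs1) (sub_nonneg.2 hp1), mul_nonneg hs (sub_nonneg.2 hp1),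
      sq_nonneg (s * (2 * p - 1)), sq_nonneg (1 - s),
      mul_nonneg (mul_nonneg hs (sub_nonneg.2 hs1)) (sub_nonneg.2 hp1), sq_nonneg (s * p),
      mul_nonneg (sq_nonneg (1 - s)) (sub_nonneg.2 hp1), sq_nonneg (s * p - (1 - p)),
      mul_nonneg (mul_nonneg hs (sub_nonneg.2 hs1)) hp]
  rw [h1]
  nlinarith

/-- The estimate on the primal step obtained by testing the three-point inequality at all points
`x̂ + t (x - x̂)`, `0 ≤ t`, of the ray from the critical point through the iterate. -/
theorem primal_step_estimate {X Y : Type*} [NormedAddCommGroup X] [InnerProductSpace ℝ X]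
    [CompleteSpace X] [NormedAddCommGroup Y] [InnerProductSpace ℝ Y] [CompleteSpace Y]
    (K : X →L[ℝ] Y) {τ σ j α t γ γbar Lbar ebar : ℝ} (hτ : 0 < τ) (hσ : 0 < σ)
    (hj : 0 < j) (hj1 : j < 1) (hα : 1 ≤ α) (ht : 0 ≤ t) (hμ : 0 ≤ 1 - τ * σ * ‖K‖ ^ 2)
    (hL : 2 * τ * Lbar ≤ j * (1 - τ * σ * ‖K‖ ^ 2)) {x q q' e g : X} {y : Y} {v w : X × Y}
    (hq : γ * ‖x - v.1‖ ^ 2 ≤ ⟪q - q', x - v.1⟫)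
    (hv : q' + e + (ContinuousLinearMap.adjoint K) v.2 = 0)
    (hx : q + g + (ContinuousLinearMap.adjoint K) y + τ⁻¹ • (x - w.1)
        - (ContinuousLinearMap.adjoint K) (y - w.2) = 0)
    (hmono : ∀ x' : X, ⟪g - e, x' - v.1⟫
        ≥ γbar * ‖x' - v.1‖ ^ 2 - Lbar * ‖x' - w.1‖ ^ 2 - ebar) :
    ‖x - v.1‖ ^ 2 * (2 * (1 + τ * γ) * t
        + (2 * τ * γbar - (α⁻¹ + j * (α - 1) ^ 2 / (α * (α - j)))) * t ^ 2)
      ≤ α * (τ * Mquad K τ σ (w - v)) + 2 * τ * ebar := by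
  have hY := Mquad_young K hτ hσ hj hj1 hα hμ hL (w - v) (t • (x - v.1))
  have hm := hmono (v.1 + t • (x - v.1))
  have e1 : v.1 + t • (x - v.1) - v.1 = t • (x - v.1) := by abel
  have e2 : t • (x - v.1) - (w - v).1 = v.1 + t • (x - v.1) - w.1 := by
    rw [Prod.fst_sub]; abel
  have e3 : τ • (q - q') = (w - v).1 - τ • (ContinuousLinearMap.adjoint K) (w - v).2
      - (x - v.1) - τ • (g - e) := by
    have h : q - q' = -(g - e) - (ContinuousLinearMap.adjoint K) (w - v).2 - τ⁻¹ • (x - w.1) := by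
      rw [Prod.snd_sub, map_sub, ← sub_eq_zero]
      rw [map_sub] at hx
      rw [← sub_eq_zero.2 (hx.trans hv.symm)]
      abel
    rw [h, smul_sub, smul_sub, smul_inv_smul₀ hτ.ne', Prod.fst_sub, smul_neg]
    abel
  have e4 : τ * ⟪q - q', x - v.1⟫
      = ⟪(w - v).1 - τ • (ContinuousLinearMap.adjoint K) (w - v).2, x - v.1⟫
        - ‖x - v.1‖ ^ 2 - τ * ⟪g - e, x - v.1⟫ := by
    rw [← real_inner_smul_left, e3, inner_sub_left, inner_sub_left _ (x - v.1),
      real_inner_self_eq_norm_sq, real_inner_smul_left _ _ τ]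
  rw [e2, real_inner_smul_right, norm_smul, mul_pow, Real.norm_eq_abs, sq_abs] at hY
  rw [e1, real_inner_smul_right, norm_smul, mul_pow, Real.norm_eq_abs, sq_abs] at hm
  have h1 := mul_le_mul_of_nonneg_left hq (mul_nonneg ht hτ.le)
  have h2 := mul_le_mul_of_nonneg_left hm hτ.le
  have h3 := congrArg (fun z => t * z) e4
  linarith

theorem young_constant_eq {j : ℝ} (hj : 0 < j) (hj1 : j < 1) :
    (1 + j / 2)⁻¹ + j * (1 + j / 2 - 1) ^ 2 / ((1 + j / 2) * (1 + j / 2 - j))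
      = 1 - j * (1 - j) / (2 - j) := by
  have h1 : 2 - j ≠ 0 := by linarith
  have h2 : 1 + j / 2 - j = (2 - j) / 2 := by ring
  have h3 : 1 + j / 2 = (2 + j) / 2 := by ring
  have h4 : 2 + j ≠ 0 := by linarith
  rw [h2, h3]
  field_simp
  ring

theorem weight_bound {j G P s r : ℝ} (hj : 0 < j) (hj1 : j < 1) (hG : 0 ≤ G) (hP : 0 < P)
    (hPG : P ≤ 1 + 2 * G) (hr : 0 ≤ r) (hrj : r ≤ j) (hrs : r * P ≤ s) :
    (1 - j * (1 - j) / (2 - j) - s) * (P * (1 + r)) ≤ (1 + G) ^ 2 * (1 - r ^ 2 / (2 * j)) := by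
  obtain ⟨p, hp⟩ : ∃ p, p = P / (1 + G) ^ 2 := ⟨_, rfl⟩
  have hp0 : 0 < p := by rw [hp]; positivity
  have hp1 : p ≤ 1 := by
    rw [hp, div_le_one (by positivity)]
    nlinarith [sq_nonneg G]
  have hPp : P = p * (1 + G) ^ 2 := by rw [hp]; field_simp
  have hpP : p ≤ P := by rw [hPp]; nlinarith [mul_nonneg hp0.le hG]
  have hnum := mul_sub_le_one_sub hj hj1 hr hrj hp0.le hp1
  have h1 : 1 - j * (1 - j) / (2 - j) - s ≤ 1 - j * (1 - j) / (2 - j) - r * p := by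
    nlinarith
  calc _ ≤ (1 - j * (1 - j) / (2 - j) - r * p) * (P * (1 + r)) := by gcongr
    _ = (1 + G) ^ 2 * (p * (1 + r) * (1 - j * (1 - j) / (2 - j) - r * p)) := by
      rw [hPp]; ring
    _ ≤ _ := by gcongr

theorem sq_mul_sq_le_of_forall {N g s ν V B : ℝ} (hg : 0 < g) (hV : 0 < V) (hν : ν - s ≤ V)
    (h : ∀ t : ℝ, 0 ≤ t → N ^ 2 * (2 * g * t + (s - ν) * t ^ 2) ≤ B) :
    N ^ 2 * g ^ 2 ≤ V * B := by
  have h1 : N ^ 2 * (2 * g * (g / V) + (-V) * (g / V) ^ 2) ≤ B := by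
    refine le_trans ?_ (h (g / V) (by positivity))
    gcongr
    linarith
  have h2 : 2 * g * (g / V) + (-V) * (g / V) ^ 2 = g ^ 2 / V := by
    field_simp; ring
  rw [h2, mul_div_assoc', div_le_iff₀ hV] at h1
  linarith

theorem radius_bounds {j μ G s θ D T S E A N b : ℝ} (hj : 0 < j) (hj1 : j < 1) (hμ : 0 < μ)
    (hG : 0 ≤ G) (hμ1 : μ ≤ 1) (hθ : 0 < θ) (hθμ : θ ≤ (1 + j) * μ) (hθs : θ ≤ μ + 2 * G + s)
    (hD : 0 < D) (hT : 0 < T) (hS : 1 < S) (hA : A ≤ S * θ * D ^ 2)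
    (hTS : (1 + j) * S * D ^ 2 + E / θ ≤ T ^ 2)
    (hest : ∀ α t : ℝ, 1 ≤ α → 0 ≤ t →
      N ^ 2 * (2 * (1 + G) * t + (s - (α⁻¹ + j * (α - 1) ^ 2 / (α * (α - j)))) * t ^ 2)
        ≤ α * A + E)
    (hbD : b ^ 2 * (μ + 2 * G) ≤ θ * D ^ 2) :
    N < T ∧ N + b < T + D := by
  have hNT : N < T := by
    have h := hest 1 1 le_rfl zero_le_one
    norm_num at h
    have h1 : N ^ 2 * θ ≤ N ^ 2 * (2 * (1 + G) + (s - 1)) := by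
      gcongr; linarith
    have h2 : N ^ 2 ≤ S * D ^ 2 + E / θ := by
      rw [← mul_le_mul_iff_left₀ hθ, add_mul, div_mul_cancel₀ _ hθ.ne']
      linarith
    have h3 : 0 < j * (S * D ^ 2) := by positivity
    exact lt_of_pow_lt_pow_left₀ 2 hT.le (by linarith)
  refine ⟨hNT, ?_⟩
  have hP : 0 < μ + 2 * G := by linarith
  obtain ⟨P, hPdef⟩ : ∃ P, P = μ + 2 * G := ⟨_, rfl⟩
  rw [← hPdef] at hP hbD hθs
  rcases le_or_gt θ P with hle | hlt
  · have : b ≤ D := by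
      refine le_of_sq_le_sq ?_ hD.le
      rw [← mul_le_mul_iff_left₀ hP]
      nlinarith [sq_nonneg D]
    linarith
  obtain ⟨r, hr⟩ : ∃ r, r = θ / P - 1 := ⟨_, rfl⟩
  have hθP : θ = P * (1 + r) := by rw [hr]; field_simp; ring
  have hr0 : 0 < r := by
    have : 1 < θ / P := by rwa [one_lt_div hP]
    linarith
  have hrj : r ≤ j := by
    have : P * (1 + r) ≤ P * (1 + j) := by nlinarith
    linarith [le_of_mul_le_mul_left this hP]
  have hrs : r * P ≤ s := by linarith
  have hg : 0 < 1 + G := by linarith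
  obtain ⟨R, hR⟩ : ∃ R, R = 1 - r ^ 2 / (2 * j) := ⟨_, rfl⟩
  have hR0 : 0 < R := by
    have : r ^ 2 / (2 * j) < 1 := by
      rw [div_lt_one (by positivity)]
      nlinarith
    linarith
  have hVν : 1 - j * (1 - j) / (2 - j) - s ≤ (1 + G) ^ 2 * R / θ := by
    rw [le_div_iff₀ hθ, hθP, hR]
    exact weight_bound hj hj1 hG hP (by linarith) hr0.le hrj hrs
  have hNR : N ^ 2 ≤ R * ((1 + j / 2) * S * D ^ 2 + E / θ) := by
    have h := sq_mul_sq_le_of_forall hg (by positivity) hVν fun t ht => by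
      have h := hest (1 + j / 2) t (by linarith) ht
      rwa [young_constant_eq hj hj1] at h
    have h4 : (1 + j / 2) * A + E ≤ ((1 + j / 2) * S * D ^ 2 + E / θ) * θ := by
      rw [add_mul _ _ θ, div_mul_cancel₀ _ hθ.ne']
      have := mul_le_mul_of_nonneg_left hA (by linarith : 0 ≤ 1 + j / 2)
      linarith
    refine le_of_mul_le_mul_right (h.trans ?_) (pow_pos hg 2)
    calc _ ≤ (1 + G) ^ 2 * R / θ * (((1 + j / 2) * S * D ^ 2 + E / θ) * θ) := by gcongr
      _ = _ := by rw [div_mul_eq_mul_div, div_eq_iff hθ.ne']; ring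
  have hbr : b ≤ (1 + r / 2) * D := by
    refine le_of_sq_le_sq ?_ (by positivity)
    have h1 : b ^ 2 ≤ (1 + r) * D ^ 2 := by
      rw [← mul_le_mul_iff_left₀ hP]
      rw [hθP] at hbD
      linarith
    linarith [sq_nonneg (r * D)]
  have hfin : N + r / 2 * D < T := by
    refine lt_of_pow_lt_pow_left₀ 2 hT.le ?_
    have h1 : (N + r / 2 * D) ^ 2 ≤ N ^ 2 / R + (r / 2 * D) ^ 2 / (1 - R) := by
      have hR1 : 0 < 1 - R := by rw [hR, sub_sub_cancel]; positivity
      rw [div_add_div _ _ hR0.ne' hR1.ne', le_div_iff₀ (by positivity)]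
      nlinarith [sq_nonneg ((1 - R) * N - R * (r / 2 * D))]
    have h2 : (r / 2 * D) ^ 2 / (1 - R) = j / 2 * D ^ 2 := by
      rw [hR, sub_sub_cancel]; field_simp
    have h3 : N ^ 2 / R ≤ (1 + j / 2) * S * D ^ 2 + E / θ := by
      rw [div_le_iff₀ hR0]; linarith
    have h4 : 0 < j / 2 * D ^ 2 * (S - 1) := by
      have := sub_pos.2 hS
      positivity
    linarith
  linarith

/-- a priori estimate — the iterate and prediction stay in the ball
around a nearby critical point and the comparison point. -/
theorem stmt4
    {X Y : Type*} [NormedAddCommGroup X] [InnerProductSpace ℝ X] [CompleteSpace X]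
    [NormedAddCommGroup Y] [InnerProductSpace ℝ Y] [CompleteSpace Y]
    (K : X →L[ℝ] Y) (τ σ φ η : ℝ) (hτ : 0 < τ) (hσ : 0 < σ) (hφ : 0 < φ)
    (hη : η = φ * τ)
    (γ ρ γE γhat Lbar : ℝ) (hγ : 0 ≤ γ) (hρ : 0 ≤ ρ) (hγE : 0 ≤ γE)
    (hγhat : 0 ≤ γhat ∧ γE ≤ γhat) (hLbar : 0 ≤ Lbar)
    (γbar ebar : ℝ) (hebar : 0 ≤ ebar) (κ : ℝ) (hκ : 0 < κ ∧ κ < 1)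
    (hstepcond : max (-2 * (γ + γbar)) (2 * Lbar / (1 - κ)) * τ + τ * σ * ‖K‖ ^ 2 ≤ 1)
    (θ : ℝ) (hθdef : θ = φ * (1 + 2 * τ * min (γ + γbar) Lbar - τ * σ * ‖K‖ ^ 2))
    (hθ : 0 < θ)
    (F : X → EReal) (Gs : Y → EReal) (hF : ProperConvex F) (hGs : ProperConvex Gs)
    (E : X → ℝ) (E' : X → X) (hE : ∀ z : X, HasGradientAt E (E' z) z)
    (g : X) (u ubrev ubar : X × Y)
    -- (a) the erroneous three-point monotonicity-like property at critical points
    (hmono : ∀ uhat : X × Y, IsCriticalPoint γ ρ F Gs E' K uhat →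
      ∀ x' : X, ⟪g - E' uhat.1, x' - uhat.1⟫
        ≥ γbar * ‖x' - uhat.1‖ ^ 2 - Lbar * ‖x' - ubrev.1‖ ^ 2 - ebar)
    -- (b) the implicit update inclusion
    (hinc : ∃ q p, IsStrongSubgradient γ F u.1 q ∧ IsStrongSubgradient ρ Gs u.2 p ∧
      q + g + (ContinuousLinearMap.adjoint K) u.2 + τ⁻¹ • (u.1 - ubrev.1)
        - (ContinuousLinearMap.adjoint K) (u.2 - ubrev.2) = 0 ∧
      p - K u.1 + σ⁻¹ • (u.2 - ubrev.2) - K (u.1 - ubrev.1) = 0)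
    -- (c) critical point proximity of the comparison point
    (rhat : ℝ) (hrhat : 0 < rhat)
    (hprox : (⨅ uhat ∈ {v : X × Y | IsCriticalPoint γ ρ F Gs E' K v},
        ENNReal.ofReal (Real.sqrt (Mquad K τ σ (ubar - uhat)
          + 2 * (γ + γhat) * ‖(ubar - uhat).1‖ ^ 2 + 2 * ρ * ‖(ubar - uhat).2‖ ^ 2)))
      ≤ ENNReal.ofReal rhat)
    -- (d) bounds on the prediction and the radii
    (Δ ξ δ δtil : ℝ) (hΔ : 0 < Δ) (hξ : 0 < ξ) (hδtil : 0 < δtil) (hδ : δtil < δ)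
    (hpred : η * Mquad K τ σ (ubrev - ubar)
        ≤ θ * (δ - δtil) ^ 2 / ξ - (1 + Δ) * η * rhat ^ 2 / ξ)
    (hradii : (2 - κ) * (ξ⁻¹ + 1) * (δ - δtil) ^ 2 + 2 * θ⁻¹ * η * ebar ≤ δtil ^ 2) :
    ∃ uhat : X × Y, IsCriticalPoint γ ρ F Gs E' K uhat ∧
      (Mquad K τ σ (ubar - uhat) + 2 * (γ + γhat) * ‖(ubar - uhat).1‖ ^ 2
          + 2 * ρ * ‖(ubar - uhat).2‖ ^ 2 ≤ (1 + Δ) * rhat ^ 2) ∧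
      ‖u.1 - uhat.1‖ < δ ∧ ‖ubrev.1 - uhat.1‖ < δ ∧
      ‖ubrev.1 - ubar.1‖ < δ ∧ ‖u.1 - ubar.1‖ < δ := by
  obtain ⟨hκ0, hκ1⟩ := hκ
  obtain ⟨q, p, hq, -, hx, -⟩ := hinc
  have hD : 0 < δ - δtil := sub_pos.2 hδ
  obtain ⟨uhat, hcrit, hclose⟩ : ∃ v, IsCriticalPoint γ ρ F Gs E' K v ∧
      Mquad K τ σ (ubar - v) + 2 * (γ + γhat) * ‖(ubar - v).1‖ ^ 2
        + 2 * ρ * ‖(ubar - v).2‖ ^ 2 ≤ (1 + Δ) * rhat ^ 2 := by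
    have hr : rhat < Real.sqrt (1 + Δ) * rhat := by
      have : 1 < Real.sqrt (1 + Δ) := Real.lt_sqrt_of_sq_lt (by linarith)
      nlinarith
    have hlt := hprox.trans_lt ((ENNReal.ofReal_lt_ofReal_iff (hrhat.trans hr)).2 hr)
    obtain ⟨v, hlt⟩ := iInf_lt_iff.1 hlt
    obtain ⟨hv, hvr⟩ := iInf_lt_iff.1 hlt
    refine ⟨v, hv, ?_⟩
    rw [ENNReal.ofReal_lt_ofReal_iff (hrhat.trans hr), Real.sqrt_lt' (hrhat.trans hr), mul_pow,
      Real.sq_sqrt (by linarith)] at hvr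
    exact hvr.le
  refine ⟨uhat, hcrit, hclose, ?_⟩
  have hm := hmono uhat hcrit
  obtain ⟨q', p', hq', -, hv, -⟩ := hcrit
  have hk : 0 ≤ τ * σ * ‖K‖ ^ 2 := by positivity
  have hL : 2 * τ * Lbar ≤ (1 - κ) * (1 - τ * σ * ‖K‖ ^ 2) := by
    have h1 := mul_le_mul_of_nonneg_right
      (le_max_right (-2 * (γ + γbar)) (2 * Lbar / (1 - κ))) hτ.le
    have h2 : 2 * Lbar / (1 - κ) * τ ≤ 1 - τ * σ * ‖K‖ ^ 2 := by linarith
    rw [div_mul_eq_mul_div, div_le_iff₀ (by linarith)] at h2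
    linarith
  have hθ' : 0 < 1 + 2 * τ * min (γ + γbar) Lbar - τ * σ * ‖K‖ ^ 2 :=
    pos_of_mul_pos_right (hθdef ▸ hθ) hφ.le
  obtain ⟨θ', hθ'def⟩ : ∃ t, t = 1 + 2 * τ * min (γ + γbar) Lbar - τ * σ * ‖K‖ ^ 2 := ⟨_, rfl⟩
  rw [← hθ'def] at hθ' hθdef
  have hML : ∀ w : X × Y, (1 - τ * σ * ‖K‖ ^ 2) * ‖w.1‖ ^ 2 ≤ τ * Mquad K τ σ w :=
    mul_Mquad_ge K hτ hσ
  have hest : ∀ α t : ℝ, 1 ≤ α → 0 ≤ t → 0 ≤ 1 - τ * σ * ‖K‖ ^ 2 → _ := fun α t hα ht hμ =>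
    primal_step_estimate K hτ hσ (sub_pos.2 hκ1) (by linarith : 1 - κ < 1) hα ht hμ hL
      (hq.inner_sub_ge hq') hv hx hm
  obtain ⟨μ, hμdef⟩ : ∃ m, m = 1 - τ * σ * ‖K‖ ^ 2 := ⟨_, rfl⟩
  simp only [← hμdef] at hL hML hest
  have hθμ : θ' ≤ (2 - κ) * μ := by
    have := mul_le_mul_of_nonneg_left (min_le_right (γ + γbar) Lbar) hτ.le
    linarith
  have hθs : θ' ≤ μ + 2 * (τ * γ) + 2 * τ * γbar := by
    have := mul_le_mul_of_nonneg_left (min_le_left (γ + γbar) Lbar) hτ.le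
    linarith
  have hμ : 0 < μ := pos_of_mul_pos_right (hθ'.trans_le hθμ) (by linarith)
  have hM : ∀ w : X × Y, 0 ≤ Mquad K τ σ w := fun w =>
    nonneg_of_mul_nonneg_right (le_trans (by positivity) (hML w)) hτ
  obtain ⟨D, hDdef⟩ : ∃ d, d = δ - δtil := ⟨_, rfl⟩
  rw [← hDdef] at hD hpred hradii
  have hpred' : ξ * (τ * Mquad K τ σ (ubrev - ubar)) ≤ θ' * D ^ 2 - τ * ((1 + Δ) * rhat ^ 2) := by
    rw [← sub_div, le_div_iff₀ hξ, hη, hθdef] at hpred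
    refine le_of_mul_le_mul_left ?_ hφ
    linarith
  have hEθ : 2 * θ⁻¹ * η * ebar = 2 * τ * ebar / θ' := by
    rw [hθdef, hη]; field_simp
  rw [hEθ] at hradii
  have hEθ0 : 0 ≤ 2 * τ * ebar / θ' := by positivity
  have hbar : τ * Mquad K τ σ (ubar - uhat) + (2 * τ * γ) * ‖(ubar - uhat).1‖ ^ 2
      ≤ τ * ((1 + Δ) * rhat ^ 2) := by
    have h1 := mul_le_mul_of_nonneg_left hclose hτ.le
    have h2 : 0 ≤ τ * (2 * γhat * ‖(ubar - uhat).1‖ ^ 2 + 2 * ρ * ‖(ubar - uhat).2‖ ^ 2) := by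
      have := hγhat.1
      positivity
    linarith
  have hA : τ * Mquad K τ σ (ubrev - uhat) ≤ (ξ⁻¹ + 1) * θ' * D ^ 2 := by
    have h1 := mul_le_mul_of_nonneg_left
      (Mquad_add_le K hξ hM (ubrev - ubar) (ubar - uhat)) hτ.le
    rw [sub_add_sub_cancel] at h1
    have h2 := mul_le_mul_of_nonneg_left hpred' (by positivity : 0 ≤ ξ⁻¹ + 1)
    have h3 : (ξ⁻¹ + 1) * (ξ * (τ * Mquad K τ σ (ubrev - ubar)))
        = (1 + ξ) * (τ * Mquad K τ σ (ubrev - ubar)) := by field_simp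
    have h4 : τ * Mquad K τ σ (ubar - uhat) ≤ τ * ((1 + Δ) * rhat ^ 2) := by
      have : 0 ≤ 2 * τ * γ * ‖(ubar - uhat).1‖ ^ 2 := by positivity
      linarith
    have h5 := mul_le_mul_of_nonneg_left h4 (by positivity : 0 ≤ ξ⁻¹ + 1)
    linarith
  have hball : ∀ (w : X × Y) (c : ℝ), c * D ^ 2 * (2 - κ) ≤ δtil ^ 2 →
      τ * Mquad K τ σ w ≤ c * θ' * D ^ 2 → ‖w.1‖ < δ := by
    intro w c hc hw
    refine lt_of_le_of_lt (le_of_sq_le_sq ?_ hδtil.le) hδ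
    refine le_of_mul_le_mul_left ?_ hθ'
    calc θ' * ‖w.1‖ ^ 2 ≤ (2 - κ) * μ * ‖w.1‖ ^ 2 := by gcongr
      _ = (2 - κ) * (μ * ‖w.1‖ ^ 2) := by ring
      _ ≤ (2 - κ) * (c * θ' * D ^ 2) := by
        exact mul_le_mul_of_nonneg_left ((hML w).trans hw) (by linarith)
      _ = θ' * (c * D ^ 2 * (2 - κ)) := by ring
      _ ≤ θ' * δtil ^ 2 := by gcongr
  have hrad : (ξ⁻¹ + 1) * D ^ 2 * (2 - κ) ≤ δtil ^ 2 := by linarith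
  have hR0 : 0 ≤ τ * ((1 + Δ) * rhat ^ 2) := by positivity
  have hbarD : ‖(ubar - uhat).1‖ ^ 2 * (μ + 2 * (τ * γ)) ≤ θ' * D ^ 2 := by
    have h1 := hML (ubar - uhat)
    have h2 := mul_nonneg hξ.le (mul_nonneg hτ.le (hM (ubrev - ubar)))
    linarith
  obtain ⟨hN, hNb⟩ := radius_bounds (j := 1 - κ) (μ := μ) (G := τ * γ) (s := 2 * τ * γbar)
    (θ := θ') (D := D) (T := δtil) (S := ξ⁻¹ + 1) (E := 2 * τ * ebar)
    (A := τ * Mquad K τ σ (ubrev - uhat)) (N := ‖u.1 - uhat.1‖) (b := ‖(ubar - uhat).1‖)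
    (by linarith) (by linarith) hμ (by positivity) (by linarith) hθ' (by linarith) hθs hD hδtil
    (by linarith [inv_pos.2 hξ]) hA (by linarith)
    (fun α t hα ht => hest α t hα ht hμ.le) hbarD
  refine ⟨hN.trans hδ, hball (ubrev - uhat) (ξ⁻¹ + 1) hrad hA, hball (ubrev - ubar) ξ⁻¹ ?_ ?_, ?_⟩
  · have : 0 ≤ D ^ 2 * (2 - κ) := mul_nonneg (sq_nonneg D) (by linarith)
    linarith
  · refine le_of_mul_le_mul_left ?_ hξ
    have : ξ * (ξ⁻¹ * θ' * D ^ 2) = θ' * D ^ 2 := by field_simp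
    linarith
  · have h1 := norm_sub_le (u.1 - uhat.1) (ubar - uhat).1
    rw [Prod.fst_sub] at h1 hNb
    rw [sub_sub_sub_cancel_right] at h1
    linarith
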